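/- The kissing number in dimension 17 is at most 12210: every finite set of unit vectors x_1, …, x_N in ℝ^{17} satisfying ⟨x_i, x_j⟩ ≤ 1/2 for all i ≠ j has N ≤ 12210. -/

import Mathlib

open scoped RealInnerProductSpace BigOperators

open MvPolynomial
open scoped Nat

section Fischer

variable {ι : Type*} [Fintype ι]

/-- The Fischer inner product on real polynomials: distinct monomials are orthogonal and the
monomial with exponent `m` has squared norm `∏ i, (m i)!`. -/
noncomputable def fischer : MvPolynomial ι ℝ →ₗ[ℝ] MvPolynomial ι ℝ →ₗ[ℝ] ℝ :=
  (basisMonomials ι ℝ).constr ℝ fun m => (∏ i, ((m i)! : ℝ)) • lcoeff ℝ m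

lemma fischer_monomial (m : ι →₀ ℕ) (a : ℝ) (q : MvPolynomial ι ℝ) :
    fischer (monomial m a) q = a * ((∏ i, ((m i)! : ℝ)) * coeff m q) := by
  have h : fischer (monomial m (1 : ℝ)) = (∏ i, ((m i)! : ℝ)) • lcoeff ℝ m := by
    have := (basisMonomials ι ℝ).constr_basis ℝ
      (fun m => (∏ i, ((m i)! : ℝ)) • lcoeff (R := ℝ) m) m
    rwa [coe_basisMonomials] at this
  rw [← mul_one a, ← smul_eq_mul, ← smul_monomial, map_smul, h]
  simp

lemma fischer_self_nonneg (p : MvPolynomial ι ℝ) : 0 ≤ fischer p p := by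
  have h : fischer p p = ∑ m ∈ p.support, (∏ i, ((m i)! : ℝ)) * coeff m p ^ 2 := by
    conv_lhs => enter [1]; rw [← support_sum_monomial_coeff p]
    rw [map_sum, LinearMap.sum_apply]
    refine Finset.sum_congr rfl fun m _ => ?_
    rw [fischer_monomial]
    ring
  rw [h]
  positivity

lemma fischer_X_mul (i : ι) (p q : MvPolynomial ι ℝ) :
    fischer (X i * p) q = fischer p (pderiv i q) := by
  classical
  induction p using MvPolynomial.induction_on' with
  | monomial m a =>
    have hX : X i * monomial m a = monomial (m + Finsupp.single i 1) a := by
      rw [mul_comm, X, monomial_mul, mul_one]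
    have hprod : ∏ l, (((m + Finsupp.single i 1 : ι →₀ ℕ) l)! : ℝ)
        = (∏ l, ((m l)! : ℝ)) * (m i + 1) := by
      rw [← Finset.mul_prod_erase _ _ (Finset.mem_univ i),
        ← Finset.mul_prod_erase _ (fun l => ((m l)! : ℝ)) (Finset.mem_univ i)]
      have : ∏ l ∈ Finset.univ.erase i, (((m + Finsupp.single i 1 : ι →₀ ℕ) l)! : ℝ)
          = ∏ l ∈ Finset.univ.erase i, ((m l)! : ℝ) :=
        Finset.prod_congr rfl fun l hl => by
          simp [Finsupp.single_eq_of_ne (Finset.ne_of_mem_erase hl)]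
      rw [this]
      simp [Nat.factorial_succ]
      ring
    rw [hX, fischer_monomial, fischer_monomial, hprod, coeff_pderiv]
    ring
  | add p q hp hq => simp only [mul_add, map_add, LinearMap.add_apply, hp, hq]

/-- The linear form `y ↦ ⟪x, y⟫` as a polynomial. -/
noncomputable def linForm (x : EuclideanSpace ℝ ι) : MvPolynomial ι ℝ := ∑ i, C (x i) * X i

variable (ι) in
/-- The polynomial `y ↦ ‖y‖ ^ 2`. -/
noncomputable def sqNorm : MvPolynomial ι ℝ := ∑ i, X i ^ 2

/-- The Laplace operator on polynomials. -/
noncomputable def laplacian : MvPolynomial ι ℝ →ₗ[ℝ] MvPolynomial ι ℝ :=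
  ∑ i, (pderiv i).toLinearMap ∘ₗ (pderiv i).toLinearMap

lemma laplacian_apply (p : MvPolynomial ι ℝ) : laplacian p = ∑ i, pderiv i (pderiv i p) := by
  simp [laplacian]

lemma fischer_sqNorm_mul (p q : MvPolynomial ι ℝ) :
    fischer (sqNorm ι * p) q = fischer p (laplacian q) := by
  simp only [sqNorm, laplacian_apply, Finset.sum_mul, map_sum, LinearMap.sum_apply]
  refine Finset.sum_congr rfl fun i _ => ?_
  rw [pow_two, mul_assoc, fischer_X_mul, fischer_X_mul]

lemma fischer_linForm_pow (x : EuclideanSpace ℝ ι) (k : ℕ) {q : MvPolynomial ι ℝ}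
    (hq : q.IsHomogeneous k) : fischer (linForm x ^ k) q = k ! * eval x q := by
  induction k generalizing q with
  | zero =>
    obtain ⟨a, rfl⟩ : ∃ a, q = C a :=
      ⟨_, totalDegree_eq_zero_iff_eq_C.1 ((totalDegree_zero_iff_isHomogeneous _).2 hq)⟩
    have := fischer_monomial (0 : ι →₀ ℕ) 1 (C a)
    simpa using this
  | succ k ih =>
    have euler := congrArg (eval (x : ι → ℝ)) hq.sum_X_mul_pderiv
    simp only [map_sum, map_mul, eval_X, nsmul_eq_mul, map_natCast] at euler
    rw [pow_succ', linForm, Finset.sum_mul, map_sum, LinearMap.sum_apply, ← linForm]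
    have h : ∀ i, fischer (C (x i) * X i * linForm x ^ k) q
        = k ! * (x i * eval x (pderiv i q)) := fun i => by
      rw [mul_assoc, ← smul_eq_C_mul, map_smul, LinearMap.smul_apply, fischer_X_mul,
        ih (by simpa using hq.pderiv (i := i)), smul_eq_mul]
      ring
    simp only [h, ← Finset.mul_sum, euler]
    rw [Nat.factorial_succ]
    push_cast
    ring

lemma isHomogeneous_linForm (x : EuclideanSpace ℝ ι) : (linForm x).IsHomogeneous 1 :=
  IsHomogeneous.sum _ _ _ fun i _ => isHomogeneous_C_mul_X (x i) i

variable (ι) in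
lemma isHomogeneous_sqNorm : (sqNorm ι).IsHomogeneous 2 :=
  IsHomogeneous.sum _ _ _ fun i _ => isHomogeneous_X_pow i 2

lemma pderiv_linForm (x : EuclideanSpace ℝ ι) (i : ι) : pderiv i (linForm x) = C (x i) := by
  classical
  simp [linForm, pderiv_X, Pi.single_apply]

lemma pderiv_sqNorm (i : ι) : pderiv i (sqNorm ι) = 2 * X i := by
  classical
  simp [sqNorm, pderiv_X, Pi.single_apply]

lemma laplacian_sqNorm_mul {p : MvPolynomial ι ℝ} {d : ℕ} (hp : p.IsHomogeneous d) :
    laplacian (sqNorm ι * p)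
      = sqNorm ι * laplacian p + ((4 * d + 2 * Fintype.card ι : ℕ) : MvPolynomial ι ℝ) * p := by
  have two (i : ι) : pderiv i (2 : MvPolynomial ι ℝ) = 0 := pderiv_C (a := (2 : ℝ))
  have h (i : ι) : pderiv i (pderiv i (sqNorm ι * p))
      = sqNorm ι * pderiv i (pderiv i p) + 4 * (X i * pderiv i p) + 2 * p := by
    simp only [pderiv_mul, pderiv_sqNorm, map_add, two, pderiv_X_self]
    ring
  simp only [laplacian_apply, h, Finset.sum_add_distrib, ← Finset.mul_sum, hp.sum_X_mul_pderiv]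
  simp
  ring

lemma laplacian_linForm_pow {x : EuclideanSpace ℝ ι} (hx : ‖x‖ = 1) (a : ℕ) :
    laplacian (linForm x ^ a) = ((a * (a - 1) : ℕ) : MvPolynomial ι ℝ) * linForm x ^ (a - 2) := by
  have hx' : ∑ i, (C (x i) : MvPolynomial ι ℝ) ^ 2 = 1 := by
    have := EuclideanSpace.real_norm_sq_eq x
    rw [hx] at this
    simp only [← map_pow, ← map_sum, ← this, one_pow, map_one]
  have nat (i : ι) (m : ℕ) : pderiv i (m : MvPolynomial ι ℝ) = 0 := by
    rw [← map_natCast (C : ℝ →+* MvPolynomial ι ℝ), pderiv_C]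
  have h (i : ι) : pderiv i (pderiv i (linForm x ^ a))
      = ((a * (a - 1) : ℕ) : MvPolynomial ι ℝ) * linForm x ^ (a - 2) * C (x i) ^ 2 := by
    simp only [pderiv_pow, pderiv_linForm, pderiv_mul, pderiv_C, nat, Nat.sub_sub]
    push_cast
    ring
  simp only [laplacian_apply, h, ← Finset.mul_sum, hx', mul_one]

lemma laplacian_sqNorm_pow_mul_linForm_pow {x : EuclideanSpace ℝ ι} (hx : ‖x‖ = 1) (a b : ℕ) :
    laplacian (sqNorm ι ^ b * linForm x ^ a)
      = ((a * (a - 1) : ℕ) : MvPolynomial ι ℝ) * (sqNorm ι ^ b * linForm x ^ (a - 2))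
        + C (2 * b * (2 * a + Fintype.card ι + 2 * b - 2) : ℝ)
          * (sqNorm ι ^ (b - 1) * linForm x ^ a) := by
  induction b with
  | zero => simp [laplacian_linForm_pow hx]
  | succ b ih =>
    have hom : (sqNorm ι ^ b * linForm x ^ a).IsHomogeneous (2 * b + 1 * a) :=
      ((isHomogeneous_sqNorm ι).pow b).mul ((isHomogeneous_linForm x).pow a)
    rw [pow_succ', mul_assoc, laplacian_sqNorm_mul hom, ih]
    have hC : (C 2 : MvPolynomial ι ℝ) = 2 := map_ofNat C 2
    rcases b with _ | b
    · simp [hC]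
      ring
    · simp [hC]
      ring

end Fischer

section Zonal

/-- Coefficients of the monic zonal (Gegenbauer) polynomial of degree `k` in dimension `n`. -/
noncomputable def zonalCoeff (n k : ℕ) : ℕ → ℝ
  | 0 => 1
  | j + 1 => -zonalCoeff n k j * ((k - 2 * j) * (k - 2 * j - 1))
      / (2 * (j + 1) * (n + 2 * k - 2 * j - 4))

/-- The monic zonal (Gegenbauer) polynomial of degree `k` in dimension `n`. -/
noncomputable def zonal (n k : ℕ) (t : ℝ) : ℝ :=
  ∑ j ∈ Finset.range (k / 2 + 1), zonalCoeff n k j * t ^ (k - 2 * j)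

variable {ι : Type*} [Fintype ι]

/-- The zonal harmonic polynomial of degree `k` with pole `x`. -/
noncomputable def zonalHarmonic (k : ℕ) (x : EuclideanSpace ℝ ι) : MvPolynomial ι ℝ :=
  ∑ j ∈ Finset.range (k / 2 + 1),
    zonalCoeff (Fintype.card ι) k j • (sqNorm ι ^ j * linForm x ^ (k - 2 * j))

lemma isHomogeneous_zonalHarmonic (k : ℕ) (x : EuclideanSpace ℝ ι) :
    (zonalHarmonic k x).IsHomogeneous k := by
  refine IsHomogeneous.sum _ _ _ fun j hj => ?_
  have := ((isHomogeneous_sqNorm ι).pow j).mul ((isHomogeneous_linForm x).pow (k - 2 * j))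
  rw [show 2 * j + 1 * (k - 2 * j) = k by rw [Finset.mem_range] at hj; omega] at this
  rw [smul_eq_C_mul]
  exact this.C_mul _

lemma laplacian_zonalHarmonic [Nonempty ι] (k : ℕ) {x : EuclideanSpace ℝ ι} (hx : ‖x‖ = 1) :
    laplacian (zonalHarmonic k x) = 0 := by
  have key : ∀ m, 2 * m ≤ k → laplacian (∑ j ∈ Finset.range (m + 1),
      zonalCoeff (Fintype.card ι) k j • (sqNorm ι ^ j * linForm x ^ (k - 2 * j)))
      = (zonalCoeff (Fintype.card ι) k m * ((k - 2 * m) * (k - 2 * m - 1) : ℝ))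
        • (sqNorm ι ^ m * linForm x ^ (k - 2 * m - 2)) := by
    intro m
    induction m with
    | zero =>
      intro _
      have : ((k * (k - 1) : ℕ) : ℝ) = k * (k - 1) := by cases k <;> simp
      have h := laplacian_sqNorm_pow_mul_linForm_pow hx k 0
      rw [← map_natCast (C : ℝ →+* MvPolynomial ι ℝ), this] at h
      simpa [zonalCoeff, smul_eq_C_mul] using h
    | succ m ih =>
      intro hm
      obtain ⟨a, rfl⟩ := Nat.exists_eq_add_of_le hm
      rw [Finset.sum_range_succ, map_add, ih (by omega), map_smul,
        laplacian_sqNorm_pow_mul_linForm_pow hx]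
      have e1 : 2 * (m + 1) + a - 2 * m - 2 = a := by omega
      have e2 : 2 * (m + 1) + a - 2 * (m + 1) = a := by omega
      have cast : ((a * (a - 1) : ℕ) : ℝ) = a * (a - 1) := by cases a <;> simp
      rw [← map_natCast (C : ℝ →+* MvPolynomial ι ℝ), e1, e2, cast, add_tsub_cancel_right,
        ← smul_eq_C_mul, ← smul_eq_C_mul, smul_add, smul_smul, smul_smul, add_left_comm,
        ← add_smul]
      have hn : (0 : ℝ) < Fintype.card ι := by exact_mod_cast Fintype.card_pos
      have hd : (Fintype.card ι + 2 * (2 * (m + 1) + a) - 2 * m - 4 : ℝ) ≠ 0 := by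
        have : (0 : ℝ) ≤ a := a.cast_nonneg
        have : (0 : ℝ) ≤ m := m.cast_nonneg
        apply ne_of_gt
        linarith
      have hm1 : (m + 1 : ℝ) ≠ 0 := by positivity
      have cancel : zonalCoeff (Fintype.card ι) (2 * (m + 1) + a) m *
            (((2 * (m + 1) + a : ℕ) - 2 * m) * ((2 * (m + 1) + a : ℕ) - 2 * m - 1) : ℝ)
          + zonalCoeff (Fintype.card ι) (2 * (m + 1) + a) (m + 1) *
            (2 * (m + 1 : ℕ) * (2 * a + Fintype.card ι + 2 * (m + 1 : ℕ) - 2)) = 0 := by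
        rw [zonalCoeff]
        push_cast
        field_simp
        ring
      rw [cancel, zero_smul, add_zero]
      push_cast
      ring_nf
  rw [zonalHarmonic, key _ (by omega)]
  obtain ⟨m, h | h⟩ := Nat.even_or_odd' k
  · have : k / 2 = m := by omega
    rw [this, h]
    simp
  · have : k / 2 = m := by omega
    rw [this, h]
    simp

lemma eval_zonalHarmonic (k : ℕ) (x : EuclideanSpace ℝ ι) {y : EuclideanSpace ℝ ι}
    (hy : ‖y‖ = 1) : eval y (zonalHarmonic k x) = zonal (Fintype.card ι) k ⟪x, y⟫ := by
  have hL : eval y (linForm x) = ⟪x, y⟫ := by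
    simp [linForm, PiLp.inner_apply, mul_comm]
  have hR : eval y (sqNorm ι) = 1 := by
    simp [sqNorm, ← EuclideanSpace.real_norm_sq_eq, hy]
  simp [zonalHarmonic, zonal, smul_eval, hL, hR]

/-- Zonal polynomials are positive definite kernels on the unit sphere (Schoenberg). -/
theorem sum_zonal_inner_nonneg [Nonempty ι] {κ : Type*} [Fintype κ] (k : ℕ)
    {x : κ → EuclideanSpace ℝ ι} (hx : ∀ i, ‖x i‖ = 1) :
    0 ≤ ∑ i, ∑ j, zonal (Fintype.card ι) k ⟪x i, x j⟫ := by
  obtain ⟨F, hF⟩ : ∃ F : MvPolynomial ι ℝ, F = ∑ i, zonalHarmonic k (x i) := ⟨_, rfl⟩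
  have hharm : laplacian F = 0 := by
    rw [hF, map_sum]
    exact Finset.sum_eq_zero fun i _ => laplacian_zonalHarmonic k (hx i)
  have hhom : F.IsHomogeneous k := hF ▸
    IsHomogeneous.sum _ _ _ fun i _ => isHomogeneous_zonalHarmonic k (x i)
  have hrep (y : EuclideanSpace ℝ ι) : fischer (zonalHarmonic k y) F = k ! * eval y F := by
    rw [zonalHarmonic, Finset.sum_range_succ', map_add, map_sum, LinearMap.add_apply,
      LinearMap.sum_apply, Finset.sum_eq_zero, zero_add]
    · simpa [zonalCoeff] using fischer_linForm_pow y k hhom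
    · intro j _
      rw [map_smul, LinearMap.smul_apply, pow_succ', mul_assoc, fischer_sqNorm_mul, hharm,
        map_zero, smul_zero]
  have hsum : fischer F F = k ! * ∑ i, ∑ j, zonal (Fintype.card ι) k ⟪x i, x j⟫ := by
    have hF' := congrArg (fun p => fischer p F) hF
    simp only [map_sum, LinearMap.sum_apply, hrep, ← Finset.mul_sum] at hF'
    rw [hF', Finset.sum_comm]
    simp only [hF, map_sum, eval_zonalHarmonic k _ (hx _)]
  have := fischer_self_nonneg F
  rw [hsum] at this
  exact nonneg_of_mul_nonneg_right this (by positivity)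

end Zonal

section SphericalCode

variable {E : Type*} [NormedAddCommGroup E] [InnerProductSpace ℝ E]

/-- Unit vectors at pairwise angle at least `π / 3` which all lie in the half space opposite to a
unit vector `e` cannot be too concentrated around `-e`. -/
lemma sum_two_mul_inner_sq_sub_one_le {κ : Type*} [DecidableEq κ] (s : Finset κ) {y : κ → E}
    {e : E} (he : ‖e‖ = 1) (hy : ∀ j ∈ s, ‖y j‖ = 1) (hneg : ∀ j ∈ s, ⟪e, y j⟫ ≤ 0)
    (hsep : ∀ i ∈ s, ∀ j ∈ s, i ≠ j → ⟪y i, y j⟫ ≤ 1 / 2) :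
    ∑ j ∈ s, (2 * ⟪e, y j⟫ ^ 2 - 1) ≤ 1 := by
  set a : κ → ℝ := fun j => ⟪e, y j⟫ with ha
  set A := ∑ j ∈ s, a j ^ 2 with hA
  set v := ∑ j ∈ s, a j • y j with hv
  have hA₀ : 0 ≤ A := Finset.sum_nonneg fun j _ => sq_nonneg _
  have hev : ⟪e, v⟫ = A := by
    rw [hv, inner_sum, hA]
    exact Finset.sum_congr rfl fun j _ => by rw [real_inner_smul_right, pow_two]
  have hAv : A ≤ ‖v‖ := by
    simpa [hev, he] using real_inner_le_norm e v
  have hvv : ‖v‖ ^ 2 ≤ ((∑ j ∈ s, a j) ^ 2 + A) / 2 := by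
    calc ‖v‖ ^ 2 = ∑ i ∈ s, ∑ j ∈ s, a i * a j * ⟪y i, y j⟫ := by
          rw [← real_inner_self_eq_norm_sq, hv, sum_inner]
          refine Finset.sum_congr rfl fun i _ => ?_
          rw [inner_sum]
          refine Finset.sum_congr rfl fun j _ => ?_
          rw [real_inner_smul_left, real_inner_smul_right, mul_assoc]
      _ ≤ ∑ i ∈ s, ∑ j ∈ s, (a i * a j / 2 + if i = j then a i ^ 2 / 2 else 0) := by
          refine Finset.sum_le_sum fun i hi => Finset.sum_le_sum fun j hj => ?_
          split_ifs with hij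
          · rw [← hij, real_inner_self_eq_norm_sq, hy i hi]
            linarith
          · have := mul_le_mul_of_nonneg_left (hsep i hi j hj hij)
              (mul_nonneg_of_nonpos_of_nonpos (hneg i hi) (hneg j hj))
            linarith
      _ = ((∑ j ∈ s, a j) ^ 2 + A) / 2 := by
          simp only [Finset.sum_add_distrib, pow_two (∑ j ∈ s, a j), Finset.sum_mul_sum,
            Finset.sum_ite_eq, ← Finset.sum_div]
          rw [Finset.sum_congr rfl fun i hi => if_pos hi, ← Finset.sum_div]
          ring
  have hcs : (∑ j ∈ s, a j) ^ 2 ≤ s.card * A := sq_sum_le_card_mul_sum_sq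
  have hsum : ∑ j ∈ s, (2 * a j ^ 2 - 1) = 2 * A - s.card := by
    simp [hA, Finset.mul_sum]
  rw [hsum]
  have hcard : (0 : ℝ) ≤ s.card := Nat.cast_nonneg _
  by_contra! h
  nlinarith [mul_self_le_mul_self hA₀ hAv]

/-- Combining the Delsarte inequality for `f`, which is allowed to be positive near `-1`, with the
bound on the concentration of a code in a cap. -/
theorem card_mul_le_of_zonal_expansion {ι : Type*} [Fintype ι] [Nonempty ι] {d N : ℕ} (hN : 0 < N)
    {w : Fin (d + 1) → ℝ} (hw : ∀ k, 0 ≤ w k) {f : ℝ → ℝ}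
    (hf : ∀ t, f t = ∑ k, w k * zonal (Fintype.card ι) k t) {r μ : ℝ} (hr : r ≤ 0) (hμ : 0 ≤ μ)
    (hcap : ∀ t, -1 ≤ t → t ≤ r → f t ≤ μ * (2 * t ^ 2 - 1))
    (hnonpos : ∀ t, r ≤ t → t ≤ 1 / 2 → f t ≤ 0)
    {x : Fin N → EuclideanSpace ℝ ι} (hx : ∀ i, ‖x i‖ = 1)
    (hsep : ∀ i j, i ≠ j → ⟪x i, x j⟫ ≤ 1 / 2) :
    N * w 0 ≤ f 1 + μ := by
  have hlower : N ^ 2 * w 0 ≤ ∑ i, ∑ j, f ⟪x i, x j⟫ := by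
    have h : ∑ i, ∑ j, f ⟪x i, x j⟫
        = ∑ k, w k * ∑ i, ∑ j, zonal (Fintype.card ι) k ⟪x i, x j⟫ := by
      simp only [hf, Finset.mul_sum]
      rw [Finset.sum_comm (s := (Finset.univ : Finset (Fin (d + 1))))]
      exact Finset.sum_congr rfl fun i _ => Finset.sum_comm
    rw [h, Fin.sum_univ_succ]
    have h₀ : ∑ i, ∑ j, zonal (Fintype.card ι) (0 : Fin (d + 1)) ⟪x i, x j⟫ = (N : ℝ) ^ 2 := by
      simp [zonal, zonalCoeff, pow_two]
    have := Finset.sum_nonneg fun (k : Fin d) (_ : k ∈ Finset.univ) =>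
      mul_nonneg (hw k.succ) (sum_zonal_inner_nonneg (k.succ : ℕ) hx)
    rw [h₀]
    linarith
  have hrow (i : Fin N) : ∑ j, f ⟪x i, x j⟫ ≤ f 1 + μ := by
    rw [← Finset.add_sum_erase _ _ (Finset.mem_univ i), real_inner_self_eq_norm_sq, hx, one_pow]
    gcongr
    set s := (Finset.univ.erase i).filter fun j => ⟪x i, x j⟫ ≤ r
    calc ∑ j ∈ Finset.univ.erase i, f ⟪x i, x j⟫ ≤ ∑ j ∈ s, f ⟪x i, x j⟫ := by
          rw [← Finset.sum_filter_add_sum_filter_not (Finset.univ.erase i)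
            (fun j => ⟪x i, x j⟫ ≤ r)]
          refine add_le_of_nonpos_right (Finset.sum_nonpos fun j hj => ?_)
          simp only [Finset.mem_filter, Finset.mem_erase, not_le] at hj
          exact hnonpos _ hj.2.le (hsep i j hj.1.1.symm)
      _ ≤ ∑ j ∈ s, μ * (2 * ⟪x i, x j⟫ ^ 2 - 1) := by
          refine Finset.sum_le_sum fun j hj => hcap _ ?_ (Finset.mem_filter.1 hj).2
          have := neg_le_of_abs_le (abs_real_inner_le_norm (x i) (x j))
          rwa [hx, hx, mul_one] at this
      _ ≤ μ := by
          rw [← Finset.mul_sum]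
          exact mul_le_of_le_one_right hμ (sum_two_mul_inner_sq_sub_one_le s (hx i)
            (fun j _ => hx j) (fun j hj => (Finset.mem_filter.1 hj).2.trans hr)
            fun j _ l _ => hsep j l)
  have hupper : ∑ i, ∑ j, f ⟪x i, x j⟫ ≤ N * (f 1 + μ) := by
    simpa [mul_add] using Finset.sum_le_sum fun i (_ : i ∈ Finset.univ) => hrow i
  have hN' : (0 : ℝ) < N := by exact_mod_cast hN
  refine le_of_mul_le_mul_left ?_ hN'
  linarith [pow_two (N : ℝ)]

end SphericalCode

/-- A polynomial of degree `13` with nonnegative zonal coefficients in dimension `17` that is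
nonpositive on `[-17/24, 1/2]`. -/
def capPoly (t : ℝ) : ℝ :=
  (2 * t - 1) * (24 * t + 17) * (100 * t - 19) ^ 2 * (200 * t + 23) ^ 2 * (50 * t + 19) ^ 2
    * (200 * t + 107) ^ 2 * (968 - 460 * t - 812 * t ^ 2 + 681 * t ^ 3)

/-- The coefficients of `capPoly` with respect to the zonal polynomials. -/
noncomputable def capWeight : Fin 14 → ℝ :=
  ![1379862140811340736658/7429,
    663970365212154199090643/266133,
    76937104542115536153168/4669,
    4428096135924719225970593/62031,
    1831328562824692408458634/8091,
    4419507619812242107352428/8091,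
    916822192541778762782200/899,
    308386971001660817960000/217,
    107802854089756810000000/77,
    185330169021246800000000/259,
    1274634720000000000/37,
    32800000000000000,
    909993600000000000000,
    1307520000000000000000]

lemma capWeight_nonneg (k : Fin 14) : 0 ≤ capWeight k := by
  fin_cases k <;> simp [capWeight] <;> norm_num

lemma capPoly_eq_sum_zonal (t : ℝ) : capPoly t = ∑ k, capWeight k * zonal 17 k t := by
  simp [capPoly, capWeight, Fin.sum_univ_succ, zonal, zonalCoeff, Finset.sum_range_succ]
  ring

lemma capPoly_nonpos {t : ℝ} (h₁ : -17 / 24 ≤ t) (h₂ : t ≤ 1 / 2) : capPoly t ≤ 0 := by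
  have hq : 0 ≤ 968 - 460 * t - 812 * t ^ 2 + 681 * t ^ 3 := by
    nlinarith [mul_nonneg (sub_nonneg.2 h₁) (sub_nonneg.2 h₂), sq_nonneg t,
      mul_nonneg (sq_nonneg t) (sub_nonneg.2 h₁)]
  have h := mul_nonneg (mul_nonneg (sub_nonneg.2 h₂) (sub_nonneg.2 h₁)) (mul_nonneg
    (sq_nonneg ((100 * t - 19) * (200 * t + 23) * (50 * t + 19) * (200 * t + 107))) hq)
  rw [capPoly]
  linear_combination 48 * h

lemma capPoly_le {t : ℝ} (h₁ : -1 ≤ t) (h₂ : t ≤ -17 / 24) :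
    capPoly t ≤ 5090000000000000000 * (2 * t ^ 2 - 1) := by
  rcases le_total t (-93 / 100) with h₃ | h₃
  on_goal 2 => rcases le_total t (-89 / 100) with h₄ | h₄
  on_goal 3 => rcases le_total t (-17 / 20) with h₅ | h₅
  · obtain ⟨u, hu⟩ : ∃ u, u = (100/7) * (t - (-1)) := ⟨_, rfl⟩
    obtain ⟨v, hv⟩ : ∃ v, v = (100/7) * (-93/100 - t) := ⟨_, rfl⟩
    have hu₀ : 0 ≤ u := by linarith
    have hv₀ : 0 ≤ v := by linarith
    have key : 5090000000000000000 * (2 * t ^ 2 - 1) - capPoly t = 10123410974211129965 * v ^ 13 +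
      (10731195472119697323681/100) * (u * v ^ 12) + (5207975036139926991058093/10000) * (u ^ 2 *
      v ^ 11) + (1530554365320518425774017979/1000000) * (u ^ 3 * v ^ 10) +
      (151762440386702900568720079823/50000000) * (u ^ 4 * v ^ 9) +
      (10706707086332906597964136632911/2500000000) * (u ^ 5 * v ^ 8) +
      (4415229405437036895307573587663/1000000000) * (u ^ 6 * v ^ 7) +
      (16799678379705905961624996371847/5000000000) * (u ^ 7 * v ^ 6) +
      (4705444058731467375267428274917/2500000000) * (u ^ 8 * v ^ 5) +
      (955017795104055527380490528367/1250000000) * (u ^ 9 * v ^ 4) +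
      (1087870825665189532916492213407/5000000000) * (u ^ 10 * v ^ 3) +
      (204933520506777678098393533047/5000000000) * (u ^ 11 * v ^ 2) +
      (142549730042325586029409491/31250000) * (u ^ 12 * v) + (177138316888715865041743/781250) *
      u ^ 13 := by
      rw [capPoly, hu, hv]
      ring
    rw [← sub_nonneg, key]
    positivity
  · obtain ⟨u, hu⟩ : ∃ u, u = (25) * (t - (-93/100)) := ⟨_, rfl⟩
    obtain ⟨v, hv⟩ : ∃ v, v = (25) * (-89/100 - t) := ⟨_, rfl⟩
    have hu₀ : 0 ≤ u := by linarith
    have hv₀ : 0 ≤ v := by linarith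
    have key : 5090000000000000000 * (2 * t ^ 2 - 1) - capPoly t =
      (177138316888715865041743/781250) * v ^ 13 + (15822580444076871568611857/7812500) * (u * v ^
      12) + (2469459587787320766708154983/312500000) * (u ^ 2 * v ^ 11) +
      (5485716410037379328854627333/312500000) * (u ^ 3 * v ^ 10) +
      (7650960612740329558691314193/312500000) * (u ^ 4 * v ^ 9) +
      (7361041470356909761465872083/312500000) * (u ^ 5 * v ^ 8) +
      (3245049686729270211255364579/156250000) * (u ^ 6 * v ^ 7) +
      (3838624967657467997064316297/156250000) * (u ^ 7 * v ^ 6) +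
      (4773723888175246679826210777/156250000) * (u ^ 8 * v ^ 5) +
      (4387892933715005521237255527/156250000) * (u ^ 9 * v ^ 4) +
      (5357038887382219847372706659/312500000) * (u ^ 10 * v ^ 3) +
      (2067779913810905292745472729/312500000) * (u ^ 11 * v ^ 2) +
      (91933199872758460641477081/62500000) * (u ^ 12 * v) + (1802029964998641901560031/12500000)
      * u ^ 13 := by
      rw [capPoly, hu, hv]
      ring
    rw [← sub_nonneg, key]
    positivity
  · obtain ⟨u, hu⟩ : ∃ u, u = (25) * (t - (-89/100)) := ⟨_, rfl⟩
    obtain ⟨v, hv⟩ : ∃ v, v = (25) * (-17/20 - t) := ⟨_, rfl⟩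
    have hu₀ : 0 ≤ u := by linarith
    have hv₀ : 0 ≤ v := by linarith
    have key : 5090000000000000000 * (2 * t ^ 2 - 1) - capPoly t =
      (1802029964998641901560031/12500000) * v ^ 13 + (142330695577064986561326949/62500000) * (u
      * v ^ 12) + (5091629656069296847936464809/312500000) * (u ^ 2 * v ^ 11) +
      (21858409382338845315511719659/312500000) * (u ^ 3 * v ^ 10) +
      (31457500133760954350097465727/156250000) * (u ^ 4 * v ^ 9) +
      (64217260670175889872770545539/156250000) * (u ^ 5 * v ^ 8) +
      (95815123741298298504781252633/156250000) * (u ^ 6 * v ^ 7) +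
      (105955670641074327954181854907/156250000) * (u ^ 7 * v ^ 6) +
      (173911516396822216204863365171/312500000) * (u ^ 8 * v ^ 5) +
      (837874358241321752199783833/2500000) * (u ^ 9 * v ^ 4) +
      (360262680058226475041066617/2500000) * (u ^ 10 * v ^ 3) +
      (20963884931477722677611807/500000) * (u ^ 11 * v ^ 2) + (92551260460817570993303/12500) *
      (u ^ 12 * v) + (14993018069626527212147/25000) * u ^ 13 := by
      rw [capPoly, hu, hv]
      ring
    rw [← sub_nonneg, key]
    positivity
  · obtain ⟨u, hu⟩ : ∃ u, u = (120/17) * (t - (-17/20)) := ⟨_, rfl⟩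
    obtain ⟨v, hv⟩ : ∃ v, v = (120/17) * (-17/24 - t) := ⟨_, rfl⟩
    have hu₀ : 0 ≤ u := by linarith
    have hv₀ : 0 ≤ v := by linarith
    have key : 5090000000000000000 * (2 * t ^ 2 - 1) - capPoly t = (14993018069626527212147/25000)
      * v ^ 13 + (5511392326321801990750789/600000) * (u * v ^ 12) +
      (3551219499508353104811414979/57600000) * (u ^ 2 * v ^ 11) +
      (3473627853898171894232709347/14400000) * (u ^ 3 * v ^ 10) +
      (85324240866693427806583174313/138240000) * (u ^ 4 * v ^ 9) +
      (851434851736993474974071242253/777600000) * (u ^ 5 * v ^ 8) +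
      (103622426268224619183876473583209/74649600000) * (u ^ 6 * v ^ 7) +
      (71240766376178772732829809424393/55987200000) * (u ^ 7 * v ^ 6) +
      (2257524255776105146099331994136813/2687385600000) * (u ^ 8 * v ^ 5) +
      (78770420767148089047437010084337/201553920000) * (u ^ 9 * v ^ 4) +
      (1476605734360042717847624241637/12093235200) * (u ^ 10 * v ^ 3) +
      (52538570920701685136769897713/2267481600) * (u ^ 11 * v ^ 2) +
      (235584768253328614147191503/113374080) * (u ^ 12 * v) + (159062500000000000/9) * u ^ 13 :=
      by
      rw [capPoly, hu, hv]
      ring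
    rw [← sub_nonneg, key]
    positivity

lemma capPoly_one_add_lt : capPoly 1 + 5090000000000000000 < 12211 * capWeight 0 := by
  norm_num [capPoly, capWeight]

/-- The kissing number in dimension 17 is at most 12210. -/
theorem kissing_dim17_le (N : ℕ)
    (x : Fin N → EuclideanSpace ℝ (Fin 17))
    (hx : ∀ i, ‖x i‖ = 1)
    (hsep : ∀ i j, i ≠ j → ⟪x i, x j⟫ ≤ 1 / 2) :
    N ≤ 12210 := by
  rcases N.eq_zero_or_pos with rfl | hN
  · exact Nat.zero_le _
  have hle := card_mul_le_of_zonal_expansion hN capWeight_nonneg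
    (fun t => by simpa using capPoly_eq_sum_zonal t) (by norm_num) (by norm_num)
    (fun t => capPoly_le) (fun t => capPoly_nonpos) hx hsep
  have hw : 0 < capWeight 0 := by norm_num [capWeight]
  have hlt : (N : ℝ) < 12211 :=
    lt_of_mul_lt_mul_right (hle.trans_lt capPoly_one_add_lt) hw.le
  have : N < 12211 := by exact_mod_cast hlt
  omega
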